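/- arXiv:math/0101181 — 6 statements merged into one kernel-verified Lean document; each statement's English description precedes it below -/
import Mathlib

section
/- For any three smooth sections e1, e2, e3 of TM ⊕ T*M, the Courant bracket satisfies [[e1,e2]_c, e3]_c + [[e2,e3]_c, e1]_c + [[e3,e1]_c, e2]_c = (1/3) d(⟨[e1,e2]_c, e3⟩_+ + ⟨[e2,e3]_c, e1⟩_+ + ⟨[e3,e1]_c, e2⟩_+); that is, the Jacobiator of the Courant bracket equals one third of the exterior derivative of the cyclic sum ⟨[e1,e2]_c, e3⟩_+ + c.p. -/
/-!
Algebraic model of the Cartan calculus of a smooth manifold `M`: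
`R` models the ring of smooth functions `C^∞(M)`, `V` the vector fields
`Γ(TM)`, and `Ω1, Ω2, Ω3` the modules of differential forms of degree
1, 2, 3.  `lie` is the Lie bracket of vector fields, `d0, d1, d2` the
exterior differentials, `ι1, ι2, ι3` the interior products and
`w11, w12` the wedge products, together with their standard identities
(Leibniz rules, skew-symmetry, the evaluation formulas for `dα`, `dω`,
and nondegeneracy of the interior-product pairings).
Sections of `TM ⊕ T*M` are modeled by `V × Ω1` and sections of
`E^1(M) = (TM × ℝ) ⊕ (T*M × ℝ)` by `(V × R) × (Ω1 × R)`; sub-bundles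
are modeled by their `R`-modules of sections.
-/

namespace ConformalDirac

noncomputable section

structure CartanCalculus (R V Ω1 Ω2 Ω3 : Type*) [CommRing R] [Algebra ℝ R]
    [AddCommGroup V] [Module ℝ V] [Module R V] [IsScalarTower ℝ R V]
    [AddCommGroup Ω1] [Module ℝ Ω1] [Module R Ω1] [IsScalarTower ℝ R Ω1]
    [AddCommGroup Ω2] [Module ℝ Ω2] [Module R Ω2] [IsScalarTower ℝ R Ω2]
    [AddCommGroup Ω3] [Module ℝ Ω3] [Module R Ω3] [IsScalarTower ℝ R Ω3] where
  lie : V →ₗ[ℝ] V →ₗ[ℝ] V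
  d0 : R →ₗ[ℝ] Ω1
  d1 : Ω1 →ₗ[ℝ] Ω2
  d2 : Ω2 →ₗ[ℝ] Ω3
  ι1 : V →ₗ[ℝ] Ω1 →ₗ[ℝ] R
  ι2 : V →ₗ[ℝ] Ω2 →ₗ[ℝ] Ω1
  ι3 : V →ₗ[ℝ] Ω3 →ₗ[ℝ] Ω2
  w11 : Ω1 →ₗ[ℝ] Ω1 →ₗ[ℝ] Ω2
  w12 : Ω1 →ₗ[ℝ] Ω2 →ₗ[ℝ] Ω3
  lie_skew : ∀ X Y, lie X Y = - lie Y X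
  lie_jacobi : ∀ X Y Z, lie (lie X Y) Z + lie (lie Y Z) X + lie (lie Z X) Y = 0
  lie_smul : ∀ (f : R) (X Y : V), lie X (f • Y) = f • lie X Y + (ι1 X (d0 f)) • Y
  ι1_smul_left : ∀ (f : R) X α, ι1 (f • X) α = f * ι1 X α
  ι1_smul_right : ∀ (f : R) X α, ι1 X (f • α) = f * ι1 X α
  ι2_smul_left : ∀ (f : R) X ω, ι2 (f • X) ω = f • ι2 X ω
  ι2_smul_right : ∀ (f : R) X ω, ι2 X (f • ω) = f • ι2 X ω
  ι3_smul_left : ∀ (f : R) X θ, ι3 (f • X) θ = f • ι3 X θ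
  ι3_smul_right : ∀ (f : R) X θ, ι3 X (f • θ) = f • ι3 X θ
  d0_mul : ∀ f g : R, d0 (f * g) = f • d0 g + g • d0 f
  d1_d0 : ∀ f : R, d1 (d0 f) = 0
  d2_d1 : ∀ α, d2 (d1 α) = 0
  d1_smul : ∀ (f : R) α, d1 (f • α) = f • d1 α + w11 (d0 f) α
  d2_smul : ∀ (f : R) ω, d2 (f • ω) = f • d2 ω + w12 (d0 f) ω
  w11_skew : ∀ α β, w11 α β = - w11 β α
  w11_smul_left : ∀ (f : R) α β, w11 (f • α) β = f • w11 α β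
  w12_smul_left : ∀ (f : R) α ω, w12 (f • α) ω = f • w12 α ω
  w12_smul_right : ∀ (f : R) α ω, w12 α (f • ω) = f • w12 α ω
  ι2_w11 : ∀ X α β, ι2 X (w11 α β) = (ι1 X α) • β - (ι1 X β) • α
  ι3_w12 : ∀ X α ω, ι3 X (w12 α ω) = (ι1 X α) • ω - w11 α (ι2 X ω)
  ι2_skew : ∀ X Y ω, ι1 Y (ι2 X ω) = - ι1 X (ι2 Y ω)
  ι3_skew : ∀ X Y θ, ι2 Y (ι3 X θ) = - ι2 X (ι3 Y θ)
  eval_d1 : ∀ X Y α, ι1 Y (ι2 X (d1 α)) =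
      ι1 X (d0 (ι1 Y α)) - ι1 Y (d0 (ι1 X α)) - ι1 (lie X Y) α
  eval_d2 : ∀ X Y Z ω, ι1 Z (ι2 Y (ι3 X (d2 ω))) =
      ι1 X (d0 (ι1 Z (ι2 Y ω))) - ι1 Y (d0 (ι1 Z (ι2 X ω)))
        + ι1 Z (d0 (ι1 Y (ι2 X ω)))
        - ι1 Z (ι2 (lie X Y) ω) + ι1 Y (ι2 (lie X Z) ω) - ι1 X (ι2 (lie Y Z) ω)
  ι1_nondeg_vec : ∀ X, (∀ α, ι1 X α = 0) → X = 0
  ι1_nondeg_form : ∀ α, (∀ X, ι1 X α = 0) → α = 0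
  ι2_nondeg : ∀ ω, (∀ X, ι2 X ω = 0) → ω = 0
  ι3_nondeg : ∀ θ, (∀ X, ι3 X θ = 0) → θ = 0

namespace CartanCalculus

variable {R V Ω1 Ω2 Ω3 : Type*} [CommRing R] [Algebra ℝ R]
    [AddCommGroup V] [Module ℝ V] [Module R V] [IsScalarTower ℝ R V]
    [AddCommGroup Ω1] [Module ℝ Ω1] [Module R Ω1] [IsScalarTower ℝ R Ω1]
    [AddCommGroup Ω2] [Module ℝ Ω2] [Module R Ω2] [IsScalarTower ℝ R Ω2]
    [AddCommGroup Ω3] [Module ℝ Ω3] [Module R Ω3] [IsScalarTower ℝ R Ω3]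
    (C : CartanCalculus R V Ω1 Ω2 Ω3)

/-- `X ⬝ f = i_X (df)`, the action of a vector field on a function. -/
def Xdot (X : V) (f : R) : R := C.ι1 X (C.d0 f)

/-- Lie derivative of a 1-form, via Cartan's magic formula
`L_X α = d (i_X α) + i_X (dα)`. -/
def lieD (X : V) (α : Ω1) : Ω1 := C.d0 (C.ι1 X α) + C.ι2 X (C.d1 α)

/-- The Courant bracket on sections of `TM ⊕ T*M`:
`[X1+α1, X2+α2]_c = [X1,X2] + L_{X1}α2 − L_{X2}α1 + (1/2) d(i_{X2}α1 − i_{X1}α2)`. -/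
def courant (e1 e2 : V × Ω1) : V × Ω1 :=
  (C.lie e1.1 e2.1,
    C.lieD e1.1 e2.2 - C.lieD e2.1 e1.2
      + (2⁻¹ : ℝ) • C.d0 (C.ι1 e2.1 e1.2 - C.ι1 e1.1 e2.2))

/-- The canonical symmetric pairing on `TM ⊕ T*M`:
`⟨X1+α1, X2+α2⟩_+ = (1/2)(i_{X2}α1 + i_{X1}α2)`. -/
def pairPlus (e1 e2 : V × Ω1) : R :=
  (2⁻¹ : ℝ) • (C.ι1 e2.1 e1.2 + C.ι1 e1.1 e2.2)

/-- A sub-bundle of `TM ⊕ T*M` (given by its module of sections) is isotropic. -/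
def IsIsotropicT (L : Submodule R (V × Ω1)) : Prop :=
  ∀ e1 ∈ L, ∀ e2 ∈ L, C.pairPlus e1 e2 = 0

/-- Maximally isotropic sub-bundle of `TM ⊕ T*M`. -/
def IsMaxIsotropicT (L : Submodule R (V × Ω1)) : Prop :=
  C.IsIsotropicT L ∧ ∀ e, (∀ e' ∈ L, C.pairPlus e e' = 0) → e ∈ L

/-- A Dirac structure on `M`: a maximally isotropic sub-bundle of `TM ⊕ T*M`
whose sections are closed under the Courant bracket. -/
def IsDiracT (L : Submodule R (V × Ω1)) : Prop :=
  C.IsMaxIsotropicT L ∧ ∀ e1 ∈ L, ∀ e2 ∈ L, C.courant e1 e2 ∈ L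

/-! Sections of `E^1(M) = (TM × ℝ) ⊕ (T*M × ℝ)` are modeled by
`(V × R) × (Ω1 × R)`; an element `((X,f),(α,g))` is the section
`(X,f)+(α,g)` of the paper. -/

/-- The canonical symmetric pairing on `E^1(M)`:
`⟨(X1,μ1)+(α1,λ1), (X2,μ2)+(α2,λ2)⟩_+
  = (1/2)(i_{X2}α1 + i_{X1}α2 + λ1 μ2 + λ2 μ1)`. -/
def pairPlusE (e1 e2 : (V × R) × (Ω1 × R)) : R :=
  (2⁻¹ : ℝ) • (C.ι1 e2.1.1 e1.2.1 + C.ι1 e1.1.1 e2.2.1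
      + e1.2.2 * e2.1.2 + e2.2.2 * e1.1.2)

/-- The skew-symmetric pairing on `E^1(M)`:
`⟨(X1,μ1)+(α1,λ1), (X2,μ2)+(α2,λ2)⟩_−
  = (1/2)(i_{X2}α1 − i_{X1}α2 + λ1 μ2 − λ2 μ1)`. -/
def pairMinusE (e1 e2 : (V × R) × (Ω1 × R)) : R :=
  (2⁻¹ : ℝ) • (C.ι1 e2.1.1 e1.2.1 - C.ι1 e1.1.1 e2.2.1
      + e1.2.2 * e2.1.2 - e2.2.2 * e1.1.2)

/-- The extended Courant bracket on sections of `E^1(M)`. -/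
def ebracket (e1 e2 : (V × R) × (Ω1 × R)) : (V × R) × (Ω1 × R) :=
  ((C.lie e1.1.1 e2.1.1, C.Xdot e1.1.1 e2.1.2 - C.Xdot e2.1.1 e1.1.2),
   (C.lieD e1.1.1 e2.2.1 - C.lieD e2.1.1 e1.2.1
      + (2⁻¹ : ℝ) • C.d0 (C.ι1 e2.1.1 e1.2.1 - C.ι1 e1.1.1 e2.2.1)
      + e1.1.2 • e2.2.1 - e2.1.2 • e1.2.1
      + (2⁻¹ : ℝ) • (e2.2.2 • C.d0 e1.1.2 - e1.2.2 • C.d0 e2.1.2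
          - e1.1.2 • C.d0 e2.2.2 + e2.1.2 • C.d0 e1.2.2),
    C.Xdot e1.1.1 e2.2.2 - C.Xdot e2.1.1 e1.2.2
      + (2⁻¹ : ℝ) • (C.ι1 e2.1.1 e1.2.1 - C.ι1 e1.1.1 e2.2.1
          - e2.1.2 * e1.2.2 + e1.1.2 * e2.2.2)))

/-- Isotropic sub-bundle of `E^1(M)`. -/
def IsIsotropicE (L : Submodule R ((V × R) × (Ω1 × R))) : Prop :=
  ∀ e1 ∈ L, ∀ e2 ∈ L, C.pairPlusE e1 e2 = 0

/-- Maximally isotropic sub-bundle of `E^1(M)`. -/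
def IsMaxIsotropicE (L : Submodule R ((V × R) × (Ω1 × R))) : Prop :=
  C.IsIsotropicE L ∧ ∀ e, (∀ e' ∈ L, C.pairPlusE e e' = 0) → e ∈ L

/-- A Dirac structure of `E^1(M)`: a maximally isotropic sub-bundle whose
sections are closed under the extended Courant bracket. -/
def IsDiracE (L : Submodule R ((V × R) × (Ω1 × R))) : Prop :=
  C.IsMaxIsotropicE L ∧ ∀ e1 ∈ L, ∀ e2 ∈ L, C.ebracket e1 e2 ∈ L

/-- `f` is `L`-admissible: there are `X_f`, `φ_f` with
`(X_f, φ_f) + (df, f) ∈ Γ(L)`. -/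
def IsAdmissible (L : Submodule R ((V × R) × (Ω1 × R))) (f : R) : Prop :=
  ∃ (Xf : V) (φf : R), ((Xf, φf), (C.d0 f, f)) ∈ L

/-- `e` is a section of `L` of the form `e_f = (X_f, φ_f) + (df, f)`
witnessing admissibility of `f`. -/
def AdmSec (L : Submodule R ((V × R) × (Ω1 × R))) (f : R)
    (e : (V × R) × (Ω1 × R)) : Prop :=
  e ∈ L ∧ e.2.1 = C.d0 f ∧ e.2.2 = f

/-- The Koszul bracket of 1-forms associated to a bivector `π`:
`[α,β]_π = L_{πα}β − L_{πβ}α − d(π(α,β))`. -/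
def koszul (π : Ω1 →ₗ[R] V) (α β : Ω1) : Ω1 :=
  C.lieD (π α) β - C.lieD (π β) α - C.d0 (C.ι1 (π α) β)

/-- `π` is a skew-symmetric bivector: `i_{πα}β = −i_{πβ}α`, i.e.
`π(α,β) = −π(β,α)`. -/
def IsSkewBivector (π : Ω1 →ₗ[R] V) : Prop :=
  ∀ α β, C.ι1 (π α) β = - C.ι1 (π β) α

/-- `[π,π]_s = 0` (the Schouten–Nijenhuis square of `π` vanishes), expressed
through the standard equivalent identity `π [α,β]_π = [πα, πβ]`. -/
def IsPoissonBivector (π : Ω1 →ₗ[R] V) : Prop :=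
  ∀ α β, π (C.koszul π α β) = C.lie (π α) (π β)

/-- `(π, E)` is a Jacobi structure: `[E,π]_s = 0` and `[π,π]_s = 2 E ∧ π`.
The first condition is expressed through `[E,π]_s α = [E,πα] − π(L_E α)`;
the second through the evaluation of `(1/2)[π,π]_s(α,β,γ)
 = ⟨[πα,πβ] − π[α,β]_π, γ⟩` against `(E ∧ π)(α,β,γ)`. -/
def IsJacobiPair (π : Ω1 →ₗ[R] V) (E : V) : Prop :=
  (∀ α, C.lie E (π α) - π (C.lieD E α) = 0) ∧
  (∀ α β γ, C.ι1 (C.lie (π α) (π β) - π (C.koszul π α β)) γ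
      = C.ι1 E α * C.ι1 (π β) γ - C.ι1 E β * C.ι1 (π α) γ
        + C.ι1 E γ * C.ι1 (π α) β)

/-- The graph of the bundle map `P(α,g) = (πα + gE, −i_E α)` associated to a
pair `(π, E)`, as a sub-bundle of `E^1(M)`. -/
def jacobiGraph (π : Ω1 →ₗ[R] V) (E : V) :
    Submodule R ((V × R) × (Ω1 × R)) :=
  Submodule.span R
    {e : (V × R) × (Ω1 × R) |
      e.1.1 = π e.2.1 + e.2.2 • E ∧ e.1.2 = -(C.ι1 E e.2.1)}

/-- The twist `(X,φ)+(α,f) ↦ (aX + fY, aφ − i_Y α) + (α,f)`. -/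
def twistFun (a : R) (Y : V) (e : (V × R) × (Ω1 × R)) :
    (V × R) × (Ω1 × R) :=
  ((a • e.1.1 + e.2.2 • Y, a * e.1.2 - C.ι1 Y e.2.1), e.2)

/-- The sub-bundle of `E^1(M)` spanned by the `(a,Y)`-twists of the sections
of `L`. -/
def conf (L : Submodule R ((V × R) × (Ω1 × R))) (a : R) (Y : V) :
    Submodule R ((V × R) × (Ω1 × R)) :=
  Submodule.span R (C.twistFun a Y '' (L : Set ((V × R) × (Ω1 × R))))

end CartanCalculus
end
end ConformalDirac

namespace ConformalDirac

variable {R V Ω1 Ω2 Ω3 : Type*} [CommRing R] [Algebra ℝ R]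
    [AddCommGroup V] [Module ℝ V] [Module R V] [IsScalarTower ℝ R V]
    [AddCommGroup Ω1] [Module ℝ Ω1] [Module R Ω1] [IsScalarTower ℝ R Ω1]
    [AddCommGroup Ω2] [Module ℝ Ω2] [Module R Ω2] [IsScalarTower ℝ R Ω2]
    [AddCommGroup Ω3] [Module ℝ Ω3] [Module R Ω3] [IsScalarTower ℝ R Ω3]
    (C : CartanCalculus R V Ω1 Ω2 Ω3)


theorem lieD_add (X : V) (α β : Ω1) : C.lieD X (α + β) = C.lieD X α + C.lieD X β := by
  simp only [CartanCalculus.lieD, map_add]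
  abel

theorem lieD_sub (X : V) (α β : Ω1) : C.lieD X (α - β) = C.lieD X α - C.lieD X β := by
  simp only [CartanCalculus.lieD, map_sub]
  abel

theorem lieD_smul (X : V) (r : ℝ) (α : Ω1) : C.lieD X (r • α) = r • C.lieD X α := by
  simp only [CartanCalculus.lieD, map_smul, smul_add]

theorem lieD_d0 (X : V) (f : R) : C.lieD X (C.d0 f) = C.d0 (C.ι1 X (C.d0 f)) := by
  simp only [CartanCalculus.lieD, C.d1_d0, map_zero, add_zero]

theorem ι1_lieD (X Y : V) (α : Ω1) :
    C.ι1 Y (C.lieD X α) = C.ι1 X (C.d0 (C.ι1 Y α)) - C.ι1 (C.lie X Y) α := by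
  simp only [CartanCalculus.lieD, map_add, C.eval_d1]
  abel

theorem ι1_lie_d0 (X Y : V) (f : R) :
    C.ι1 (C.lie X Y) (C.d0 f)
      = C.ι1 X (C.d0 (C.ι1 Y (C.d0 f))) - C.ι1 Y (C.d0 (C.ι1 X (C.d0 f))) := by
  have h := C.eval_d1 X Y (C.d0 f)
  rw [C.d1_d0, map_zero, map_zero] at h
  exact (sub_eq_zero.mp h.symm).symm

theorem lieD_lie (X Y : V) (α : Ω1) :
    C.lieD (C.lie X Y) α = C.lieD X (C.lieD Y α) - C.lieD Y (C.lieD X α) := by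
  refine sub_eq_zero.mp (C.ι1_nondeg_form _ fun Z => ?_)
  have h := congrArg (fun W => C.ι1 W α) (C.lie_jacobi X Y Z)
  simp only [map_add, LinearMap.add_apply, map_zero, LinearMap.zero_apply] at h
  rw [C.lie_skew (C.lie Y Z) X, C.lie_skew (C.lie Z X) Y, C.lie_skew Z X] at h
  simp only [map_neg, LinearMap.neg_apply, neg_neg] at h
  simp only [map_sub, ι1_lieD, ι1_lie_d0]
  linear_combination -h

/-- The Jacobiator of the Courant bracket equals one third of
the exterior derivative of the cyclic sum `⟨[e1,e2]_c, e3⟩_+ + c.p.`. -/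
theorem courant_jacobiator (e1 e2 e3 : V × Ω1) :
    C.courant (C.courant e1 e2) e3 + C.courant (C.courant e2 e3) e1
        + C.courant (C.courant e3 e1) e2
      = ((0 : V), (3⁻¹ : ℝ) • C.d0 (C.pairPlus (C.courant e1 e2) e3
          + C.pairPlus (C.courant e2 e3) e1
          + C.pairPlus (C.courant e3 e1) e2)) := by
  obtain ⟨X, α⟩ := e1
  obtain ⟨Y, β⟩ := e2
  obtain ⟨Z, γ⟩ := e3
  ext
  · exact C.lie_jacobi X Y Z
  · simp only [CartanCalculus.courant, CartanCalculus.pairPlus, Prod.snd_add]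
    simp only [lieD_add, lieD_sub, lieD_smul, lieD_d0, ι1_lieD, lieD_lie, map_add, map_sub,
      map_smul]
    rw [C.lie_skew X Z, C.lie_skew Z Y, C.lie_skew Y X]
    simp only [map_neg, LinearMap.neg_apply]
    module

end ConformalDirac
end

section
/- Let F be a sub-bundle of TM, let F^⊥ ⊂ T*M be its annihilator, and set L = { Y + ξ | Y ∈ F, ξ ∈ F^⊥ } ⊂ TM ⊕ T*M. Then L is a Dirac structure on M if and only if the space Γ(F) of smooth sections of F is closed under the Lie bracket of vector fields. -/
namespace ConformalDirac

variable {R V Ω1 Ω2 Ω3 : Type*} [CommRing R] [Algebra ℝ R]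
    [AddCommGroup V] [Module ℝ V] [Module R V] [IsScalarTower ℝ R V]
    [AddCommGroup Ω1] [Module ℝ Ω1] [Module R Ω1] [IsScalarTower ℝ R Ω1]
    [AddCommGroup Ω2] [Module ℝ Ω2] [Module R Ω2] [IsScalarTower ℝ R Ω2]
    [AddCommGroup Ω3] [Module ℝ Ω3] [Module R Ω3] [IsScalarTower ℝ R Ω3]
    (C : CartanCalculus R V Ω1 Ω2 Ω3)


/-- The span of the set of pairs in `F × F^⊥` contains no further elements. -/
theorem mem_span_prod_annihilator_iff (F : Submodule R V) (e : V × Ω1) :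
    e ∈ Submodule.span R {e : V × Ω1 | e.1 ∈ F ∧ ∀ Y ∈ F, C.ι1 Y e.2 = 0}
      ↔ e.1 ∈ F ∧ ∀ Y ∈ F, C.ι1 Y e.2 = 0 := by
  refine ⟨fun he => ?_, fun he => Submodule.subset_span he⟩
  induction he using Submodule.span_induction with
  | mem x hx => exact hx
  | zero => exact ⟨F.zero_mem, fun Y _ => by simp⟩
  | add x y _ _ hx hy =>
    exact ⟨F.add_mem hx.1 hy.1, fun Y hY => by simp [hx.2 Y hY, hy.2 Y hY]⟩
  | smul f x _ hx =>
    exact ⟨F.smul_mem f hx.1, fun Y hY => by simp [C.ι1_smul_right, hx.2 Y hY]⟩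

theorem pairPlus_eq_zero_iff (e₁ e₂ : V × Ω1) :
    C.pairPlus e₁ e₂ = 0 ↔ C.ι1 e₂.1 e₁.2 + C.ι1 e₁.1 e₂.2 = 0 := by
  refine ⟨fun h => ?_, fun h => by simp [CartanCalculus.pairPlus, h]⟩
  have h2 := congrArg (fun r : R => (2 : ℝ) • r) h
  simpa only [CartanCalculus.pairPlus, smul_smul, smul_zero,
    mul_inv_cancel₀ (two_ne_zero : (2 : ℝ) ≠ 0), one_smul] using h2

/-- `F ⊕ F^⊥` is maximally isotropic as soon as `F` is recovered from its annihilator. -/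
theorem isMaxIsotropicT_span_prod_annihilator (F : Submodule R V)
    (hF : ∀ X : V, (∀ α : Ω1, (∀ Y ∈ F, C.ι1 Y α = 0) → C.ι1 X α = 0) → X ∈ F) :
    C.IsMaxIsotropicT (Submodule.span R
        {e : V × Ω1 | e.1 ∈ F ∧ ∀ Y ∈ F, C.ι1 Y e.2 = 0}) := by
  refine ⟨fun e₁ h₁ e₂ h₂ => ?_, fun e he => ?_⟩
  · rw [mem_span_prod_annihilator_iff] at h₁ h₂
    rw [pairPlus_eq_zero_iff, h₁.2 _ h₂.1, h₂.2 _ h₁.1, add_zero]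
  · simp only [mem_span_prod_annihilator_iff, pairPlus_eq_zero_iff] at he ⊢
    refine ⟨hF _ fun α hα => ?_, fun Y hY => ?_⟩
    · simpa using he (0, α) ⟨F.zero_mem, hα⟩
    · simpa using he (Y, 0) ⟨hY, fun Z _ => map_zero _⟩

/-- For a sub-bundle `F ⊂ TM` with annihilator `F^⊥ ⊂ T*M`,
the sub-bundle `L = F ⊕ F^⊥` is a Dirac structure on `M` if and only if
`Γ(F)` is closed under the Lie bracket of vector fields.  (The hypothesis
`hF` expresses that `F` is a genuine sub-bundle: it is recovered from its
annihilator.) -/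
theorem distribution_dirac_iff_involutive (F : Submodule R V)
    (hF : ∀ X : V, (∀ α : Ω1, (∀ Y ∈ F, C.ι1 Y α = 0) → C.ι1 X α = 0) → X ∈ F) :
    C.IsDiracT (Submodule.span R
        {e : V × Ω1 | e.1 ∈ F ∧ ∀ Y ∈ F, C.ι1 Y e.2 = 0})
      ↔ ∀ X ∈ F, ∀ Y ∈ F, C.lie X Y ∈ F := by
  refine ⟨fun h X hX Y hY => ?_, fun h =>
    ⟨isMaxIsotropicT_span_prod_annihilator C F hF, fun e₁ h₁ e₂ h₂ => ?_⟩⟩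
  · have hXY := h.2 (X, 0) (Submodule.subset_span ⟨hX, fun Z _ => map_zero _⟩)
      (Y, 0) (Submodule.subset_span ⟨hY, fun Z _ => map_zero _⟩)
    exact ((mem_span_prod_annihilator_iff C F _).1 hXY).1
  · rw [mem_span_prod_annihilator_iff] at h₁ h₂ ⊢
    refine ⟨h _ h₁.1 _ h₂.1, fun Y hY => ?_⟩
    simp [CartanCalculus.courant, ι1_lieD, h₁.2 _ hY, h₂.2 _ hY, h₁.2 _ h₂.1, h₂.2 _ h₁.1,
      h₁.2 _ (h _ h₂.1 _ hY), h₂.2 _ (h _ h₁.1 _ hY)]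

end ConformalDirac
end

section
/- For any three smooth sections e1, e2, e3 of E^1(M), the extended Courant bracket satisfies [[e1,e2],e3] + [[e2,e3],e1] + [[e3,e1],e2] = (0,0) + (dT(e1,e2,e3), T(e1,e2,e3)), where T(e1,e2,e3) = (1/3)(⟨[e1,e2],e3⟩_+ + ⟨[e2,e3],e1⟩_+ + ⟨[e3,e1],e2⟩_+). -/
namespace ConformalDirac

variable {R V Ω1 Ω2 Ω3 : Type*} [CommRing R] [Algebra ℝ R]
    [AddCommGroup V] [Module ℝ V] [Module R V] [IsScalarTower ℝ R V]
    [AddCommGroup Ω1] [Module ℝ Ω1] [Module R Ω1] [IsScalarTower ℝ R Ω1]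
    [AddCommGroup Ω2] [Module ℝ Ω2] [Module R Ω2] [IsScalarTower ℝ R Ω2]
    [AddCommGroup Ω3] [Module ℝ Ω3] [Module R Ω3] [IsScalarTower ℝ R Ω3]
    (C : CartanCalculus R V Ω1 Ω2 Ω3)


namespace CartanCalculus

theorem Xdot_add (X : V) (f g : R) : C.Xdot X (f + g) = C.Xdot X f + C.Xdot X g := by
  simp [Xdot]

theorem Xdot_sub (X : V) (f g : R) : C.Xdot X (f - g) = C.Xdot X f - C.Xdot X g := by
  simp [Xdot]

theorem Xdot_neg (X : V) (f : R) : C.Xdot X (-f) = - C.Xdot X f := by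
  simp [Xdot]

theorem Xdot_smul (X : V) (r : ℝ) (f : R) : C.Xdot X (r • f) = r • C.Xdot X f := by
  simp [Xdot]

theorem Xdot_mul (X : V) (f g : R) :
    C.Xdot X (f * g) = f * C.Xdot X g + g * C.Xdot X f := by
  simp [Xdot, C.d0_mul, C.ι1_smul_right]

theorem Xdot_lie (X Y : V) (f : R) :
    C.Xdot (C.lie X Y) f = C.Xdot X (C.Xdot Y f) - C.Xdot Y (C.Xdot X f) := by
  have h := C.eval_d1 X Y (C.d0 f)
  rw [C.d1_d0, map_zero, map_zero] at h
  exact (sub_eq_zero.mp h.symm).symm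

theorem ι1_d0 (X : V) (f : R) : C.ι1 X (C.d0 f) = C.Xdot X f := rfl

/-- The Leibniz rule for the Lie derivative, `i_Z (L_X α) = X ⬝ i_Z α - i_{[X,Z]} α`. -/
theorem ι1_lieD (X Z : V) (α : Ω1) :
    C.ι1 Z (C.lieD X α) = C.Xdot X (C.ι1 Z α) - C.ι1 (C.lie X Z) α := by
  rw [lieD, map_add, C.eval_d1]
  simp only [Xdot]
  ring

/-- The Jacobi identity paired with a 1-form, in Leibniz form. -/
theorem ι1_lie_lie (X Y Z : V) (α : Ω1) :
    C.ι1 (C.lie (C.lie X Y) Z) α =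
      C.ι1 (C.lie X (C.lie Y Z)) α - C.ι1 (C.lie Y (C.lie X Z)) α := by
  have h : C.lie (C.lie X Y) Z = C.lie X (C.lie Y Z) - C.lie Y (C.lie X Z) := by
    have h := C.lie_jacobi X Y Z
    rw [C.lie_skew (C.lie Y Z) X, C.lie_skew Z X, map_neg, LinearMap.neg_apply,
      C.lie_skew (C.lie X Z) Y] at h
    rw [← sub_eq_zero, ← h]
    abel
  rw [h, map_sub, LinearMap.sub_apply]

theorem ι1_form_ext {α β : Ω1} (h : ∀ X, C.ι1 X α = C.ι1 X β) : α = β :=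
  sub_eq_zero.mp (C.ι1_nondeg_form _ fun X => by rw [map_sub, h, sub_self])

end CartanCalculus

open CartanCalculus in
set_option maxHeartbeats 4000000 in
/-- Proposition 3.1 (i): the Jacobiator of the extended
Courant bracket on `E^1(M)` is `(0,0) + (dT, T)` with
`T(e1,e2,e3) = (1/3)(⟨[e1,e2],e3⟩_+ + c.p.)`. -/
theorem ebracket_jacobiator (e1 e2 e3 : (V × R) × (Ω1 × R)) :
    C.ebracket (C.ebracket e1 e2) e3 + C.ebracket (C.ebracket e2 e3) e1
        + C.ebracket (C.ebracket e3 e1) e2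
      = (((0 : V), (0 : R)),
         (C.d0 ((3⁻¹ : ℝ) • (C.pairPlusE (C.ebracket e1 e2) e3
              + C.pairPlusE (C.ebracket e2 e3) e1
              + C.pairPlusE (C.ebracket e3 e1) e2)),
          (3⁻¹ : ℝ) • (C.pairPlusE (C.ebracket e1 e2) e3
              + C.pairPlusE (C.ebracket e2 e3) e1
              + C.pairPlusE (C.ebracket e3 e1) e2))) := by
  obtain ⟨⟨X, f⟩, α, a⟩ := e1
  obtain ⟨⟨Y, g⟩, β, b⟩ := e2
  obtain ⟨⟨Z, h⟩, γ, c⟩ := e3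
  have s21 : ∀ θ, C.ι1 (C.lie Y X) θ = - C.ι1 (C.lie X Y) θ := fun θ => by
    rw [C.lie_skew, map_neg, LinearMap.neg_apply]
  have s31 : ∀ θ, C.ι1 (C.lie Z X) θ = - C.ι1 (C.lie X Z) θ := fun θ => by
    rw [C.lie_skew, map_neg, LinearMap.neg_apply]
  have s32 : ∀ θ, C.ι1 (C.lie Z Y) θ = - C.ι1 (C.lie Y Z) θ := fun θ => by
    rw [C.lie_skew, map_neg, LinearMap.neg_apply]
  refine Prod.ext (Prod.ext ?_ ?_) (Prod.ext (C.ι1_form_ext fun W => ?_) ?_)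
  · exact C.lie_jacobi X Y Z
  · simp only [ebracket, Prod.fst_add, Prod.snd_add, Xdot_sub, Xdot_lie]
    ring
  · simp only [ebracket, pairPlusE, Prod.fst_add, Prod.snd_add, map_add, map_sub, map_smul,
      ι1_d0, ι1_lieD, C.ι1_smul_right, Xdot_add, Xdot_sub, Xdot_smul, Xdot_mul, Xdot_lie,
      Xdot_neg, ι1_lie_lie, s21, s31, s32]
    algebra
  · simp only [ebracket, pairPlusE, Prod.snd_add, map_add, map_sub, map_smul,
      ι1_d0, ι1_lieD, C.ι1_smul_right, Xdot_add, Xdot_sub, Xdot_smul, Xdot_mul, Xdot_lie,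
      s21, s31, s32]
    algebra

end ConformalDirac
end

section
/- For any smooth function f on M and any two smooth sections e1, e2 of E^1(M), the extended Courant bracket satisfies [e1, f e2] = f [e1,e2] + (ρ(e1)f) e2 − ⟨e1,e2⟩_+ ((0,0)+(df,0)), where ρ((X,g)+(α,h)) h' = X·h' is the projection onto the vector field component acting on functions. -/
namespace ConformalDirac

variable {R V Ω1 Ω2 Ω3 : Type*} [CommRing R] [Algebra ℝ R]
    [AddCommGroup V] [Module ℝ V] [Module R V] [IsScalarTower ℝ R V]
    [AddCommGroup Ω1] [Module ℝ Ω1] [Module R Ω1] [IsScalarTower ℝ R Ω1]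
    [AddCommGroup Ω2] [Module ℝ Ω2] [Module R Ω2] [IsScalarTower ℝ R Ω2]
    [AddCommGroup Ω3] [Module ℝ Ω3] [Module R Ω3] [IsScalarTower ℝ R Ω3]
    (C : CartanCalculus R V Ω1 Ω2 Ω3)


/-- Proposition 3.1 (ii): the Leibniz-type rule
`[e1, f e2] = f [e1,e2] + (ρ(e1)f) e2 − ⟨e1,e2⟩_+ ((0,0)+(df,0))` for the
extended Courant bracket, where `ρ((X,g)+(α,h)) = X`. -/
theorem ebracket_leibniz (f : R) (e1 e2 : (V × R) × (Ω1 × R)) :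
    C.ebracket e1 (f • e2)
      = f • C.ebracket e1 e2 + (C.Xdot e1.1.1 f) • e2
          - (C.pairPlusE e1 e2) • ((((0 : V), (0 : R)), (C.d0 f, (0 : R)))) := by
  have smul_eq : ∀ x : Ω1, (2⁻¹ : ℝ) • x = (algebraMap ℝ R 2⁻¹) • x := fun x =>
    (algebraMap_smul R (2⁻¹ : ℝ) x).symm
  have half_add_half : (algebraMap ℝ R 2⁻¹) + algebraMap ℝ R 2⁻¹ = 1 := by
    rw [← map_add, ← map_one (algebraMap ℝ R)]
    norm_num
  obtain ⟨⟨X₁, μ₁⟩, α₁, ν₁⟩ := e1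
  obtain ⟨⟨X₂, μ₂⟩, α₂, ν₂⟩ := e2
  simp only [CartanCalculus.ebracket, CartanCalculus.pairPlusE, CartanCalculus.Xdot,
    CartanCalculus.lieD, Prod.smul_mk, Prod.mk_add_mk, Prod.mk_sub_mk, smul_zero, sub_zero,
    smul_eq_mul, C.lie_smul, C.ι1_smul_left, C.ι1_smul_right, C.ι2_smul_left,
    C.ι2_smul_right, C.d0_mul, C.d1_smul, C.ι2_w11, map_add, map_sub, smul_eq,
    Algebra.smul_def]
  generalize algebraMap ℝ R 2⁻¹ = c at half_add_half ⊢
  ext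
  · rfl
  · dsimp only
    ring
  · dsimp only
    linear_combination (norm := module) half_add_half • (C.ι1 X₂ α₁ • C.d0 f)
  · dsimp only
    ring

end ConformalDirac
end

section
/- Let ω be a differential 2-form and η a closed 1-form on M, and let L_{(ω,η)} ⊂ E^1(M) be the sub-bundle whose fibre at x is { (X, −i_X η)_x + (i_X ω + f η, f)_x | X a smooth vector field, f ∈ C^∞(M) }. Then L_{(ω,η)} is a maximally isotropic sub-bundle of (E^1(M), ⟨.,.⟩_+), and it is a Dirac structure of E^1(M) if and only if dω = η ∧ ω. -/
namespace ConformalDirac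

variable {R V Ω1 Ω2 Ω3 : Type*} [CommRing R] [Algebra ℝ R]
    [AddCommGroup V] [Module ℝ V] [Module R V] [IsScalarTower ℝ R V]
    [AddCommGroup Ω1] [Module ℝ Ω1] [Module R Ω1] [IsScalarTower ℝ R Ω1]
    [AddCommGroup Ω2] [Module ℝ Ω2] [Module R Ω2] [IsScalarTower ℝ R Ω2]
    [AddCommGroup Ω3] [Module ℝ Ω3] [Module R Ω3] [IsScalarTower ℝ R Ω3]
    (C : CartanCalculus R V Ω1 Ω2 Ω3)

/-- The module of sections `(X, −i_X η) + (i_X ω + f η, f)` of `L_{(ω,η)}`. -/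
def lcsGraph (ω : Ω2) (η : Ω1) : Submodule R ((V × R) × (Ω1 × R)) where
  carrier := {e | e.1.2 = -(C.ι1 e.1.1 η) ∧ e.2.1 = C.ι2 e.1.1 ω + e.2.2 • η}
  zero_mem' := by simp
  add_mem' := by
    rintro a b ⟨ha, ha'⟩ ⟨hb, hb'⟩
    refine ⟨?_, ?_⟩
    · simp only [Prod.fst_add, Prod.snd_add, map_add, LinearMap.add_apply, ha, hb]
      ring
    · simp only [Prod.fst_add, Prod.snd_add, map_add, LinearMap.add_apply, ha', hb', add_smul]
      abel
  smul_mem' := by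
    rintro c a ⟨ha, ha'⟩
    refine ⟨?_, ?_⟩
    · simp [ha, C.ι1_smul_left]
    · simp [ha', C.ι2_smul_left, smul_smul]

theorem mem_lcsGraph {ω : Ω2} {η : Ω1} {e : (V × R) × (Ω1 × R)} :
    e ∈ lcsGraph C ω η ↔ e.1.2 = -(C.ι1 e.1.1 η) ∧ e.2.1 = C.ι2 e.1.1 ω + e.2.2 • η :=
  Iff.rfl

theorem span_eq_lcsGraph (ω : Ω2) (η : Ω1) :
    Submodule.span R {e : (V × R) × (Ω1 × R) |
      e.1.2 = -(C.ι1 e.1.1 η) ∧ e.2.1 = C.ι2 e.1.1 ω + e.2.2 • η} = lcsGraph C ω η :=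
  Submodule.span_eq (lcsGraph C ω η)

theorem ι1_ext {α β : Ω1} (h : ∀ Z, C.ι1 Z α = C.ι1 Z β) : α = β :=
  sub_eq_zero.1 <| C.ι1_nondeg_form _ fun Z => by rw [map_sub, h, sub_self]

theorem pairPlusE_eq_zero_iff (e1 e2 : (V × R) × (Ω1 × R)) :
    C.pairPlusE e1 e2 = 0 ↔ C.ι1 e2.1.1 e1.2.1 + C.ι1 e1.1.1 e2.2.1
      + e1.2.2 * e2.1.2 + e2.2.2 * e1.1.2 = 0 :=
  IsUnit.smul_eq_zero (IsUnit.mk0 _ (by norm_num))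

theorem isMaxIsotropicE_lcsGraph (ω : Ω2) (η : Ω1) :
    C.IsMaxIsotropicE (lcsGraph C ω η) := by
  refine ⟨?_, ?_⟩
  · rintro e1 ⟨h1, h1'⟩ e2 ⟨h2, h2'⟩
    rw [pairPlusE_eq_zero_iff, h1, h1', h2, h2']
    simp only [map_add, C.ι1_smul_right, C.ι2_skew e1.1.1 e2.1.1 ω]
    ring
  · intro e he
    have hφ := he ((0, 0), (η, 1)) (by simp [mem_lcsGraph])
    simp only [pairPlusE_eq_zero_iff, map_zero, LinearMap.zero_apply] at hφ
    refine ⟨by linear_combination hφ, ι1_ext C fun Y => ?_⟩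
    have hα := he ((Y, -(C.ι1 Y η)), (C.ι2 Y ω, 0)) (by simp [mem_lcsGraph])
    simp only [pairPlusE_eq_zero_iff, C.ι2_skew Y e.1.1 ω] at hα
    simp only [map_add, C.ι1_smul_right]
    linear_combination hα

theorem ι1_ι2_ι3_w12 (X Y Z : V) (η : Ω1) (ω : Ω2) :
    C.ι1 Z (C.ι2 Y (C.ι3 X (C.w12 η ω))) =
      C.ι1 X η * C.ι1 Z (C.ι2 Y ω) - C.ι1 Y η * C.ι1 Z (C.ι2 X ω)
        + C.ι1 Y (C.ι2 X ω) * C.ι1 Z η := by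
  simp only [C.ι3_w12, C.ι2_w11, map_sub, C.ι2_smul_right, C.ι1_smul_right]
  ring

theorem ι1_lie_of_closed {η : Ω1} (hη : C.d1 η = 0) (X Y : V) :
    C.ι1 (C.lie X Y) η = C.ι1 X (C.d0 (C.ι1 Y η)) - C.ι1 Y (C.d0 (C.ι1 X η)) := by
  have h := C.eval_d1 X Y η
  simp only [hη, map_zero] at h
  linear_combination h

/-- The defect of the graph of `(ω, η)` from being closed under the extended Courant bracket is
the contraction of `dω − η ∧ ω`. -/
theorem ebracket_form_part {ω : Ω2} {η : Ω1} (hη : C.d1 η = 0)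
    {e1 e2 : (V × R) × (Ω1 × R)} (h1 : e1 ∈ lcsGraph C ω η) (h2 : e2 ∈ lcsGraph C ω η) :
    (C.ebracket e1 e2).2.1 =
      C.ι2 (C.lie e1.1.1 e2.1.1) ω + (C.ebracket e1 e2).2.2 • η
        + C.ι2 e2.1.1 (C.ι3 e1.1.1 (C.d2 ω - C.w12 η ω)) := by
  obtain ⟨⟨X, φ⟩, ⟨α, f⟩⟩ := e1
  obtain ⟨⟨Y, ψ⟩, ⟨β, g⟩⟩ := e2
  obtain ⟨rfl, rfl⟩ : φ = -(C.ι1 X η) ∧ α = C.ι2 X ω + f • η := h1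
  obtain ⟨rfl, rfl⟩ : ψ = -(C.ι1 Y η) ∧ β = C.ι2 Y ω + g • η := h2
  refine ι1_ext C fun Z => ?_
  have half : algebraMap ℝ R 2⁻¹ * 2 = 1 := by
    rw [← map_ofNat (algebraMap ℝ R) 2, ← map_mul]
    norm_num
  simp only [CartanCalculus.ebracket, CartanCalculus.lieD, CartanCalculus.Xdot, map_add, map_sub,
    map_neg, map_smul, C.ι1_smul_right, C.d1_smul, C.d0_mul, C.ι2_w11, hη,
    smul_zero, zero_add, C.eval_d1, C.eval_d2, ι1_ι2_ι3_w12, neg_smul, Algebra.smul_def]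
  simp only [C.ι2_skew X Y ω, C.ι2_skew Y (C.lie X Z) ω, C.ι2_skew X (C.lie Y Z) ω, map_neg]
  linear_combination
    (-C.ι1 Z (C.d0 (C.ι1 X (C.ι2 Y ω))) + f * C.ι1 Z (C.d0 (C.ι1 Y η))
      - g * C.ι1 Z (C.d0 (C.ι1 X η))
      - (-C.ι1 X (C.ι2 Y ω) + f * C.ι1 Y η - g * C.ι1 X η) * C.ι1 Z η) * half

theorem ebracket_mem_lcsGraph_iff {ω : Ω2} {η : Ω1} (hη : C.d1 η = 0)
    {e1 e2 : (V × R) × (Ω1 × R)} (h1 : e1 ∈ lcsGraph C ω η) (h2 : e2 ∈ lcsGraph C ω η) :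
    C.ebracket e1 e2 ∈ lcsGraph C ω η ↔
      C.ι2 e2.1.1 (C.ι3 e1.1.1 (C.d2 ω - C.w12 η ω)) = 0 := by
  have hfun : (C.ebracket e1 e2).1.2 = -(C.ι1 (C.ebracket e1 e2).1.1 η) := by
    simp only [CartanCalculus.ebracket, CartanCalculus.Xdot, h1.1, h2.1, ι1_lie_of_closed C hη,
      map_neg]
    ring
  rw [mem_lcsGraph, and_iff_right hfun, ebracket_form_part C hη h1 h2]
  exact add_eq_left

/-- Lemma 4.2: for a 2-form `ω` and a closed 1-form `η`, the
sub-bundle `L_{(ω,η)}` with fibre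
`{(X, −i_X η) + (i_X ω + f η, f)}` is maximally isotropic in
`(E^1(M), ⟨.,.⟩_+)`, and it is a Dirac structure of `E^1(M)` if and only if
`dω = η ∧ ω`. -/
theorem lcs_dirac (ω : Ω2) (η : Ω1) (hη : C.d1 η = 0) :
    C.IsMaxIsotropicE (Submodule.span R
        {e : (V × R) × (Ω1 × R) |
          e.1.2 = -(C.ι1 e.1.1 η) ∧ e.2.1 = C.ι2 e.1.1 ω + e.2.2 • η})
    ∧ (C.IsDiracE (Submodule.span R
        {e : (V × R) × (Ω1 × R) |
          e.1.2 = -(C.ι1 e.1.1 η) ∧ e.2.1 = C.ι2 e.1.1 ω + e.2.2 • η})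
      ↔ C.d2 ω = C.w12 η ω) := by
  simp only [span_eq_lcsGraph]
  refine ⟨isMaxIsotropicE_lcsGraph C ω η, fun h => ?_, fun h =>
    ⟨isMaxIsotropicE_lcsGraph C ω η, fun e1 h1 e2 h2 => ?_⟩⟩
  · refine sub_eq_zero.1 <| C.ι3_nondeg _ fun X => C.ι2_nondeg _ fun Y => ?_
    have hmem (X : V) : ((X, -(C.ι1 X η)), (C.ι2 X ω, 0)) ∈ lcsGraph C ω η := by
      simp [mem_lcsGraph]
    exact (ebracket_mem_lcsGraph_iff C hη (hmem X) (hmem Y)).1 (h.2 _ (hmem X) _ (hmem Y))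
  · rw [ebracket_mem_lcsGraph_iff C hη h1 h2, h, sub_self, map_zero, map_zero]

end ConformalDirac
end

section
/- Let L be an isotropic sub-bundle of (E^1(M), ⟨.,.⟩_+). If e_f = (X_f, φ_f) + (df, f) and e_g = (X_g, φ_g) + (dg, g) are two smooth sections of L, then their extended Courant bracket satisfies [e_f, e_g] = ([X_f, X_g], X_f·φ_g − X_g·φ_f) + (d{f,g}, {f,g}), where {f,g} = −⟨e_f, e_g⟩_−. -/
namespace ConformalDirac

variable {R V Ω1 Ω2 Ω3 : Type*} [CommRing R] [Algebra ℝ R]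
    [AddCommGroup V] [Module ℝ V] [Module R V] [IsScalarTower ℝ R V]
    [AddCommGroup Ω1] [Module ℝ Ω1] [Module R Ω1] [IsScalarTower ℝ R Ω1]
    [AddCommGroup Ω2] [Module ℝ Ω2] [Module R Ω2] [IsScalarTower ℝ R Ω2]
    [AddCommGroup Ω3] [Module ℝ Ω3] [Module R Ω3] [IsScalarTower ℝ R Ω3]
    (C : CartanCalculus R V Ω1 Ω2 Ω3)


/-- Lemma 5.1: if `L` is an isotropic sub-bundle of
`(E^1(M), ⟨.,.⟩_+)` and `e_f = (X_f,φ_f)+(df,f)`, `e_g = (X_g,φ_g)+(dg,g)`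
are sections of `L`, then
`[e_f,e_g] = ([X_f,X_g], X_f·φ_g − X_g·φ_f) + (d{f,g}, {f,g})` where
`{f,g} = −⟨e_f,e_g⟩_−`. -/
theorem ebracket_admissible_sections (L : Submodule R ((V × R) × (Ω1 × R)))
    (hiso : C.IsIsotropicE L) (f g φf φg : R) (Xf Xg : V)
    (hf : ((Xf, φf), (C.d0 f, f)) ∈ L) (hg : ((Xg, φg), (C.d0 g, g)) ∈ L) :
    C.ebracket ((Xf, φf), (C.d0 f, f)) ((Xg, φg), (C.d0 g, g))
      = ((C.lie Xf Xg, C.Xdot Xf φg - C.Xdot Xg φf),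
         (C.d0 (-(C.pairMinusE ((Xf, φf), (C.d0 f, f)) ((Xg, φg), (C.d0 g, g)))),
          -(C.pairMinusE ((Xf, φf), (C.d0 f, f)) ((Xg, φg), (C.d0 g, g))))) := by
  refine Prod.ext rfl (Prod.ext ?_ ?_)
  · simp only [CartanCalculus.ebracket, CartanCalculus.pairMinusE, CartanCalculus.lieD,
      C.d1_d0, map_zero, map_neg, map_smul, map_add, map_sub, C.d0_mul, smul_add, smul_sub]
    generalize φf • C.d0 g = a
    generalize φg • C.d0 f = b
    generalize f • C.d0 φg = c
    generalize g • C.d0 φf = d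
    module
  · simp only [CartanCalculus.ebracket, CartanCalculus.pairMinusE, CartanCalculus.Xdot,
      mul_comm f φg, mul_comm g φf]
    module

end ConformalDirac
end
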